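/- arXiv:1503.08131 — 6 statements merged into one kernel-verified Lean document; each statement's English description precedes it below -/
import Mathlib

section
/- Let G be a connected simple graph and let i, j, h be three distinct vertices of G such that i is adjacent to j, i is adjacent to h, and j is not adjacent to h. Then the graph G' obtained from G by deleting the edge {i,h} and adding the edge {j,h} is connected. -/
open SimpleGraph

theorem SimpleGraph.Connected.of_adj_reachable {V : Type*} {G H : SimpleGraph V}
    (hG : G.Connected) (hGH : ∀ ⦃u v⦄, G.Adj u v → H.Reachable u v) : H.Connected := by
  have := hG.nonempty
  refine ⟨fun u v => ?_⟩
  obtain ⟨p⟩ := hG.preconnected u v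
  induction p with
  | nil => exact .refl _
  | cons huv _ ih => exact (hGH huv).trans ih

/-- **Rule r1 preserves connectivity.** If `G` is a connected simple graph,
`i ~ j`, `i ~ h`, `¬ j ~ h`, and `i, j, h` are distinct, then the graph obtained
by deleting the edge `{i,h}` and adding the edge `{j,h}` is connected. -/
theorem r1_preserves_connected {V : Type*} (G : SimpleGraph V) (hG : G.Connected)
    (i j h : V) (hij : i ≠ j) (hih : i ≠ h) (hjh : j ≠ h)
    (aij : G.Adj i j) (aih : G.Adj i h) (najh : ¬ G.Adj j h) :
    (G.deleteEdges {s(i, h)} ⊔ SimpleGraph.fromEdgeSet {s(j, h)}).Connected := by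
  set H := G.deleteEdges {s(i, h)} ⊔ SimpleGraph.fromEdgeSet {s(j, h)}
  have hHij : H.Adj i j := by simp [H, aij, hjh, hih]
  have hHjh : H.Adj j h := by simp [H, hjh]
  have hHih : H.Reachable i h := hHij.reachable.trans hHjh.reachable
  refine hG.of_adj_reachable fun u v huv => ?_
  by_cases he : s(u, v) = s(i, h)
  · rcases Sym2.eq_iff.mp he with ⟨rfl, rfl⟩ | ⟨rfl, rfl⟩
    · exact hHih
    · exact hHih.symm
  · exact Adj.reachable (Or.inl (deleteEdges_adj.mpr ⟨huv, he⟩))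
end

section
/- Let G be a simple graph and let i, j, h be three distinct vertices of G with i adjacent to j, i adjacent to h, j not adjacent to h, and deg(i) > deg(j). Let G' be the graph obtained from G by deleting the edge {i,h} and adding the edge {j,h}. Then the maximum degree of G' is at most the maximum degree of G, the minimum degree of G' is at least the minimum degree of G, and consequently the degree range Δ(G') − δ(G') is at most Δ(G) − δ(G). -/
open SimpleGraph
open scoped Classical

namespace SimpleGraph

variable {V : Type*} [Fintype V] {G : SimpleGraph V} {i j h : V}
  [DecidableRel G.Adj]
  [DecidableRel (G.deleteEdges {s(i, h)} ⊔ SimpleGraph.fromEdgeSet {s(j, h)}).Adj]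

/-- Moving the edge `ih` to `jh` lowers the degree of `i` by one. -/
theorem degree_moveEdge_source (hij : i ≠ j) (hih : i ≠ h) (aih : G.Adj i h) :
    (G.deleteEdges {s(i, h)} ⊔ SimpleGraph.fromEdgeSet {s(j, h)}).degree i + 1 = G.degree i := by
  have hN : (G.deleteEdges {s(i, h)} ⊔ SimpleGraph.fromEdgeSet {s(j, h)}).neighborFinset i =
      (G.neighborFinset i).erase h := by
    ext w
    simp only [mem_neighborFinset, Finset.mem_erase, sup_adj, deleteEdges_adj,
      fromEdgeSet_adj, Set.mem_singleton_iff, Sym2.eq_iff]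
    grind
  rw [← card_neighborFinset_eq_degree, hN, Finset.card_erase_add_one (by simpa using aih),
    card_neighborFinset_eq_degree]

/-- Moving the edge `ih` to `jh` raises the degree of `j` by one. -/
theorem degree_moveEdge_target (hij : i ≠ j) (hjh : j ≠ h) (najh : ¬ G.Adj j h) :
    (G.deleteEdges {s(i, h)} ⊔ SimpleGraph.fromEdgeSet {s(j, h)}).degree j = G.degree j + 1 := by
  have hN : (G.deleteEdges {s(i, h)} ⊔ SimpleGraph.fromEdgeSet {s(j, h)}).neighborFinset j =
      insert h (G.neighborFinset j) := by
    ext w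
    simp only [mem_neighborFinset, Finset.mem_insert, sup_adj, deleteEdges_adj,
      fromEdgeSet_adj, Set.mem_singleton_iff, Sym2.eq_iff]
    grind
  rw [← card_neighborFinset_eq_degree, hN, Finset.card_insert_of_notMem (by simpa using najh),
    card_neighborFinset_eq_degree]

/-- Moving the edge `ih` to `jh` preserves the degree of every vertex other than `i` and `j`. -/
theorem degree_moveEdge_of_ne (hih : i ≠ h) (hjh : j ≠ h)
    (aih : G.Adj i h) (najh : ¬ G.Adj j h) {v : V} (hvi : v ≠ i) (hvj : v ≠ j) :
    (G.deleteEdges {s(i, h)} ⊔ SimpleGraph.fromEdgeSet {s(j, h)}).degree v = G.degree v := by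
  by_cases hvh : v = h
  · subst hvh
    have hN : (G.deleteEdges {s(i, v)} ⊔ SimpleGraph.fromEdgeSet {s(j, v)}).neighborFinset v =
        insert j ((G.neighborFinset v).erase i) := by
      ext w
      simp only [mem_neighborFinset, Finset.mem_insert, Finset.mem_erase, sup_adj,
        deleteEdges_adj, fromEdgeSet_adj, Set.mem_singleton_iff, Sym2.eq_iff]
      grind
    have hj : j ∉ (G.neighborFinset v).erase i := by
      simp [G.adj_comm v j, najh]
    rw [← card_neighborFinset_eq_degree, hN, Finset.card_insert_of_notMem hj,
      Finset.card_erase_add_one (by simpa using aih.symm), card_neighborFinset_eq_degree]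
  · rw [← card_neighborFinset_eq_degree, ← card_neighborFinset_eq_degree]
    congr 1
    ext w
    simp only [mem_neighborFinset, sup_adj, deleteEdges_adj, fromEdgeSet_adj,
      Set.mem_singleton_iff, Sym2.eq_iff]
    grind

/-- If `deg j < deg i`, moving the edge `ih` to `jh` creates no degree above the maximum degree. -/
theorem degree_moveEdge_le_maxDegree (hij : i ≠ j) (hih : i ≠ h) (hjh : j ≠ h)
    (aih : G.Adj i h) (najh : ¬ G.Adj j h) (hdeg : G.degree j < G.degree i) (v : V) :
    (G.deleteEdges {s(i, h)} ⊔ SimpleGraph.fromEdgeSet {s(j, h)}).degree v ≤ G.maxDegree := by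
  have hmax := G.degree_le_maxDegree
  rcases eq_or_ne v i with rfl | hvi
  · exact (Nat.le_succ _).trans ((degree_moveEdge_source hij hih aih).trans_le (hmax v))
  rcases eq_or_ne v j with rfl | hvj
  · exact (degree_moveEdge_target hij hjh najh).trans_le ((Nat.succ_le_of_lt hdeg).trans (hmax i))
  · exact (degree_moveEdge_of_ne hih hjh aih najh hvi hvj).trans_le (hmax v)

/-- If `deg j < deg i`, moving the edge `ih` to `jh` creates no degree below the minimum degree. -/
theorem minDegree_le_degree_moveEdge (hij : i ≠ j) (hih : i ≠ h) (hjh : j ≠ h)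
    (aih : G.Adj i h) (najh : ¬ G.Adj j h) (hdeg : G.degree j < G.degree i) (v : V) :
    G.minDegree ≤ (G.deleteEdges {s(i, h)} ⊔ SimpleGraph.fromEdgeSet {s(j, h)}).degree v := by
  have hmin := G.minDegree_le_degree
  rcases eq_or_ne v i with rfl | hvi
  · have := degree_moveEdge_source hij hih aih
    have := hmin j
    lia
  rcases eq_or_ne v j with rfl | hvj
  · exact (hmin v).trans ((Nat.le_succ _).trans_eq (degree_moveEdge_target hij hjh najh).symm)
  · exact (hmin v).trans_eq (degree_moveEdge_of_ne hih hjh aih najh hvi hvj).symm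

end SimpleGraph

/-- **The degree-balancing rule r1 does not worsen the degree range.** If `i ~ j`,
`i ~ h`, `¬ j ~ h`, `deg i > deg j`, and `i, j, h` are distinct, then after deleting
`{i,h}` and adding `{j,h}` the maximum degree does not increase, the minimum degree
does not decrease, and hence the degree range `Δ − δ` does not increase. -/
theorem r1_degree_range {V : Type*} [Fintype V] (G : SimpleGraph V)
    (i j h : V) (hij : i ≠ j) (hih : i ≠ h) (hjh : j ≠ h)
    (aij : G.Adj i j) (aih : G.Adj i h) (najh : ¬ G.Adj j h)
    (hdeg : G.degree j < G.degree i) :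
    (G.deleteEdges {s(i, h)} ⊔ SimpleGraph.fromEdgeSet {s(j, h)}).maxDegree
        ≤ G.maxDegree ∧
    G.minDegree ≤ (G.deleteEdges {s(i, h)} ⊔ SimpleGraph.fromEdgeSet {s(j, h)}).minDegree ∧
    (G.deleteEdges {s(i, h)} ⊔ SimpleGraph.fromEdgeSet {s(j, h)}).maxDegree -
      (G.deleteEdges {s(i, h)} ⊔ SimpleGraph.fromEdgeSet {s(j, h)}).minDegree
        ≤ G.maxDegree - G.minDegree := by
  have : Nonempty V := ⟨i⟩
  have hmax : (G.deleteEdges {s(i, h)} ⊔ SimpleGraph.fromEdgeSet {s(j, h)}).maxDegree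
      ≤ G.maxDegree := by
    refine maxDegree_le_of_forall_degree_le _ _ fun v => ?_
    convert degree_moveEdge_le_maxDegree hij hih hjh aih najh hdeg v
  have hmin : G.minDegree ≤
      (G.deleteEdges {s(i, h)} ⊔ SimpleGraph.fromEdgeSet {s(j, h)}).minDegree := by
    refine le_minDegree_of_forall_le_degree _ _ fun v => ?_
    convert minDegree_le_degree_moveEdge hij hih hjh aih najh hdeg v
  exact ⟨hmax, hmin, tsub_le_tsub hmax hmin⟩
end

section
/- Let G be a connected regular simple graph that is not complete. Then there exist four distinct vertices i, j, h, f such that i is adjacent to j, i is adjacent to h, j is adjacent to f, i is not adjacent to f, and j is not adjacent to h. -/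
open SimpleGraph
open scoped Classical

/-- A preconnected graph in which adjacency is transitive on distinct vertices is complete. -/
theorem eq_top_of_preconnected_of_adj_trans {V : Type*} {G : SimpleGraph V}
    (hG : G.Preconnected)
    (htrans : ∀ u v w : V, G.Adj u v → G.Adj v w → u ≠ w → G.Adj u w) : G = ⊤ := by
  have adj_of_walk : ∀ {u v : V}, G.Walk u v → u ≠ v → G.Adj u v := by
    intro u v p
    induction p with
    | nil => exact fun hne => absurd rfl hne
    | @cons u v w huv p ih =>
      intro hne
      by_cases hvw : v = w
      · exact hvw ▸ huv
      · exact htrans u v w huv (ih hvw) hne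
  ext u v
  rw [top_adj]
  exact ⟨G.ne_of_adj, fun hne => (hG u v).elim fun p => adj_of_walk p hne⟩

/-- If `i` and `j` are adjacent of equal degree and `i` has a neighbor other than `j` that is not
adjacent to `j`, then `j` has a neighbor other than `i` that is not adjacent to `i`. -/
theorem exists_private_neighbor_of_degree_eq {V : Type*} [Fintype V] {G : SimpleGraph V}
    {i j h : V} (hdeg : G.degree i = G.degree j) (hij : G.Adj i j) (hih : G.Adj i h)
    (hjh : j ≠ h) (hnjh : ¬ G.Adj j h) : ∃ f, G.Adj j f ∧ i ≠ f ∧ ¬ G.Adj i f := by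
  by_contra! hcon
  have hsub : (G.neighborFinset j).erase i ⊆ (G.neighborFinset i).erase j := by
    intro f hf
    rw [Finset.mem_erase, mem_neighborFinset] at hf ⊢
    exact ⟨hf.2.ne', hcon f hf.2 hf.1.symm⟩
  have hcard : ((G.neighborFinset i).erase j).card ≤ ((G.neighborFinset j).erase i).card := by
    rw [Finset.card_erase_of_mem ((G.mem_neighborFinset i j).2 hij),
      Finset.card_erase_of_mem ((G.mem_neighborFinset j i).2 hij.symm),
      card_neighborFinset_eq_degree, card_neighborFinset_eq_degree, hdeg]
  have hmem : h ∈ (G.neighborFinset i).erase j :=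
    Finset.mem_erase.2 ⟨hjh.symm, (G.mem_neighborFinset i h).2 hih⟩
  rw [← Finset.eq_of_subset_of_card_le hsub hcard, Finset.mem_erase, mem_neighborFinset] at hmem
  exact hnjh hmem.2

/-- **A connected regular non-complete graph always admits an r2 neighbor swap.**
If `G` is connected, regular, and not complete, then there are four distinct vertices
`i, j, h, f` with `i ~ j`, `i ~ h`, `j ~ f`, `¬ i ~ f`, `¬ j ~ h`. -/
theorem regular_not_complete_r2_applicable {V : Type*} [Fintype V] (G : SimpleGraph V)
    (hG : G.Connected) (hreg : ∃ d : ℕ, G.IsRegularOfDegree d) (hnc : G ≠ ⊤) :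
    ∃ i j h f : V,
      i ≠ j ∧ i ≠ h ∧ i ≠ f ∧ j ≠ h ∧ j ≠ f ∧ h ≠ f ∧
      G.Adj i j ∧ G.Adj i h ∧ G.Adj j f ∧ ¬ G.Adj i f ∧ ¬ G.Adj j h := by
  obtain ⟨d, hd⟩ := hreg
  by_contra hcon
  refine hnc (eq_top_of_preconnected_of_adj_trans hG.preconnected fun j i h hji hih hjh => ?_)
  by_contra hnjh
  obtain ⟨f, hjf, hif, hnif⟩ :=
    exists_private_neighbor_of_degree_eq ((hd i).trans (hd j).symm) hji.symm hih hjh hnjh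
  exact hcon ⟨i, j, h, f, hji.ne', hih.ne, hif, hjh, hjf.ne, fun hhf => hnjh (hhf ▸ hjf),
    hji.symm, hih, hjf, hnif, hnjh⟩
end

section
/- Let G be a connected simple graph on n vertices whose number of edges |E| satisfies n ∣ 2|E|, and set k = 2|E|/n (the integer average degree). Then there exists a finite sequence of graphs G = G_0, G_1, …, G_T such that each G_{t+1} is obtained from G_t by an r1-rewiring (deleting an edge {i,h} and adding an edge {j,h} for distinct vertices i, j, h with i~j, i~h, ¬j~h and deg_{G_t}(i) > deg_{G_t}(j)), and G_T is a connected k-regular graph. -/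
open SimpleGraph
open scoped Classical

/-- One application of the degree-balancing rewiring rule r1: for distinct vertices
`i, j, h` with `i ~ j`, `i ~ h`, `¬ j ~ h` and `deg i > deg j`, delete the edge
`{i,h}` and add the edge `{j,h}`. -/
def R1Step {V : Type*} [Fintype V] (G G' : SimpleGraph V) : Prop :=
  ∃ i j h : V, i ≠ j ∧ i ≠ h ∧ j ≠ h ∧
    G.Adj i j ∧ G.Adj i h ∧ ¬ G.Adj j h ∧ G.degree j < G.degree i ∧
    G' = G.deleteEdges {s(i, h)} ⊔ SimpleGraph.fromEdgeSet {s(j, h)}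

namespace SimpleGraph

variable {V : Type*}

/-- The graph obtained from `G` by replacing the edge `{i,h}` by the edge `{j,h}`. -/
def rewire (G : SimpleGraph V) (i j h : V) : SimpleGraph V :=
  G.deleteEdges {s(i, h)} ⊔ SimpleGraph.fromEdgeSet {s(j, h)}

lemma rewire_adj {G : SimpleGraph V} {i j h u v : V} (hjh : j ≠ h) :
    (G.rewire i j h).Adj u v ↔
      (G.Adj u v ∧ ¬ (u = i ∧ v = h ∨ u = h ∧ v = i)) ∨ (u = j ∧ v = h ∨ u = h ∧ v = j) := by
  simp only [rewire, sup_adj, deleteEdges_adj, fromEdgeSet_adj, Set.mem_singleton_iff,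
    Sym2.eq_iff]
  grind

lemma Connected.rewire {G : SimpleGraph V} (hG : G.Connected) {i j h : V}
    (hih : i ≠ h) (hjh : j ≠ h) (aij : G.Adj i j) :
    (G.rewire i j h).Connected := by
  have hij := aij.ne
  have r₁ : (G.rewire i j h).Reachable i h := by
    have e₁ : (G.rewire i j h).Adj i j := (rewire_adj hjh).2 (by grind)
    have e₂ : (G.rewire i j h).Adj j h := (rewire_adj hjh).2 (by grind)
    exact e₁.reachable.trans e₂.reachable
  have step : ∀ u v, G.Adj u v → (G.rewire i j h).Reachable u v := by
    intro u v huv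
    by_cases c : u = i ∧ v = h ∨ u = h ∧ v = i
    · rcases c with ⟨rfl, rfl⟩ | ⟨rfl, rfl⟩
      · exact r₁
      · exact r₁.symm
    · exact ((rewire_adj hjh).2 (Or.inl ⟨huv, c⟩)).reachable
  have := hG.nonempty
  refine ⟨fun u v => ?_⟩
  obtain ⟨w⟩ := hG.preconnected u v
  induction w with
  | nil => exact Reachable.rfl
  | cons huv _ ih => exact (step _ _ huv).trans ih

section Degree

variable [Fintype V] {G : SimpleGraph V} {i j h : V}

lemma degree_rewire_left (hij : i ≠ j) (hih : i ≠ h) (hjh : j ≠ h) (aih : G.Adj i h) :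
    (G.rewire i j h).degree i = G.degree i - 1 := by
  have : (G.rewire i j h).neighborFinset i = (G.neighborFinset i).erase h := by
    ext v
    simp only [mem_neighborFinset, rewire_adj hjh, Finset.mem_erase]
    grind
  rw [← card_neighborFinset_eq_degree, this, Finset.card_erase_of_mem (by simpa using aih),
    card_neighborFinset_eq_degree]

lemma degree_rewire_right (hij : i ≠ j) (hjh : j ≠ h) (ajh : ¬ G.Adj j h) :
    (G.rewire i j h).degree j = G.degree j + 1 := by
  have : (G.rewire i j h).neighborFinset j = insert h (G.neighborFinset j) := by
    ext v
    simp only [mem_neighborFinset, rewire_adj hjh, Finset.mem_insert]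
    grind
  rw [← card_neighborFinset_eq_degree, this, Finset.card_insert_of_notMem (by simpa using ajh),
    card_neighborFinset_eq_degree]

lemma degree_rewire_of_ne (hih : i ≠ h) (hjh : j ≠ h) (aih : G.Adj i h)
    (ajh : ¬ G.Adj j h) {v : V} (hvi : v ≠ i) (hvj : v ≠ j) :
    (G.rewire i j h).degree v = G.degree v := by
  by_cases hv : v = h
  · subst hv
    have : (G.rewire i j v).neighborFinset v = insert j ((G.neighborFinset v).erase i) := by
      ext u
      simp only [mem_neighborFinset, rewire_adj hjh, Finset.mem_insert, Finset.mem_erase]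
      grind
    rw [← card_neighborFinset_eq_degree, this, Finset.card_insert_of_notMem
      (by simp [G.adj_comm v j, ajh]), Finset.card_erase_add_one (by simpa using aih.symm),
      card_neighborFinset_eq_degree]
  · have : (G.rewire i j h).neighborFinset v = G.neighborFinset v := by
      ext u
      simp only [mem_neighborFinset, rewire_adj hjh]
      grind
    rw [← card_neighborFinset_eq_degree, this, card_neighborFinset_eq_degree]

lemma sum_degree_rewire (f : ℕ → ℕ) (hij : i ≠ j) (hih : i ≠ h) (hjh : j ≠ h)
    (aih : G.Adj i h) (ajh : ¬ G.Adj j h) :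
    ∑ v, f ((G.rewire i j h).degree v) + (f (G.degree i) + f (G.degree j)) =
      ∑ v, f (G.degree v) + (f (G.degree i - 1) + f (G.degree j + 1)) := by
  have split : ∀ g : V → ℕ, ∑ v, g v = g i + (g j + ∑ v ∈ (Finset.univ.erase i).erase j, g v) := by
    intro g
    rw [Finset.add_sum_erase _ g (by simp [hij.symm]), Finset.add_sum_erase _ g (by simp)]
  have rest : ∑ v ∈ (Finset.univ.erase i).erase j, f ((G.rewire i j h).degree v) =
      ∑ v ∈ (Finset.univ.erase i).erase j, f (G.degree v) := by
    refine Finset.sum_congr rfl fun v hv => ?_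
    simp only [Finset.mem_erase] at hv
    rw [degree_rewire_of_ne hih hjh aih ajh hv.2.1 hv.1]
  rw [split, split fun v => f (G.degree v), rest, degree_rewire_left hij hih hjh aih,
    degree_rewire_right hij hjh ajh]
  ring

lemma exists_adj_not_adj_of_degree_lt (hd : G.degree j < G.degree i) (aij : G.Adj i j) :
    ∃ h, h ≠ j ∧ G.Adj i h ∧ ¬ G.Adj j h := by
  by_contra! H
  have : (G.neighborFinset i).erase j ⊆ (G.neighborFinset j).erase i := by
    intro v hv
    simp only [Finset.mem_erase, mem_neighborFinset] at hv ⊢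
    exact ⟨hv.2.ne', H v hv.1 hv.2⟩
  have := Finset.card_le_card this
  rw [Finset.card_erase_of_mem (by simpa using aij),
    Finset.card_erase_of_mem (by simpa using aij.symm), card_neighborFinset_eq_degree,
    card_neighborFinset_eq_degree] at this
  have : 0 < G.degree j := (G.degree_pos_iff_exists_adj j).2 ⟨i, aij.symm⟩
  omega

end Degree

end SimpleGraph

/-- Along any edge with unequal degrees a rewiring is available, with its effect on the graph. -/
lemma exists_r1Step_rewire {V : Type*} [Fintype V] {G : SimpleGraph V} (hG : G.Connected)
    {i j : V} (aij : G.Adj i j) (hd : G.degree j < G.degree i) :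
    ∃ h, i ≠ h ∧ j ≠ h ∧ G.Adj i h ∧ ¬ G.Adj j h ∧ R1Step G (G.rewire i j h) ∧
      (G.rewire i j h).Connected ∧
      ∑ v, (G.rewire i j h).degree v = ∑ v, G.degree v := by
  obtain ⟨h, hhj, aih, ajh⟩ := exists_adj_not_adj_of_degree_lt hd aij
  refine ⟨h, aih.ne, hhj.symm, aih, ajh,
    ⟨i, j, h, aij.ne, aih.ne, hhj.symm, aij, aih, ajh, hd, rfl⟩,
    hG.rewire aih.ne hhj.symm aij, ?_⟩
  have := sum_degree_rewire id aij.ne aih.ne hhj.symm aih ajh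
  simp only [id] at this
  omega

/-- A path from a vertex of degree more than `k` to one of degree less than `k` allows the sum of
squared degrees to be decreased. -/
lemma exists_reflTransGen_sum_sq_degree_lt {V : Type*} [Fintype V] {k : ℕ} {a b : V}
    {G : SimpleGraph V} (hG : G.Connected) (p : G.Walk a b) (hp : p.IsPath)
    (ha : k < G.degree a) (hb : G.degree b < k) :
    ∃ G' : SimpleGraph V, Relation.ReflTransGen R1Step G G' ∧ G'.Connected ∧
      ∑ v, G'.degree v = ∑ v, G.degree v ∧
      ∑ v, G'.degree v ^ 2 < ∑ v, G.degree v ^ 2 := by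
  induction hm : p.length generalizing G a with
  | zero =>
    have := p.eq_of_length_eq_zero hm
    subst this
    omega
  | succ m ih =>
    cases p with
    | nil => simp at hm
    | @cons _ c _ hac q =>
      rw [SimpleGraph.Walk.cons_isPath_iff] at hp
      rw [SimpleGraph.Walk.length_cons] at hm
      by_cases hc : k < G.degree c
      · exact ih hG q hp.1 hc hb (by omega)
      obtain ⟨h, hah, hch, aah, nch, hstep, hconn, hsum⟩ :=
        exists_r1Step_rewire hG hac (by omega)
      have hsq := sum_degree_rewire (· ^ 2) hac.ne hah hch aah nch
      obtain ⟨d, hd⟩ : ∃ d, G.degree a = d + 1 := ⟨G.degree a - 1, by omega⟩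
      rw [hd, Nat.add_sub_cancel] at hsq
      by_cases hgap : G.degree c + 1 < G.degree a
      · refine ⟨_, .single hstep, hconn, hsum, ?_⟩
        nlinarith
      have hck : G.degree c = k := by omega
      have hdk : d = k := by omega
      have hba : b ≠ a := by rintro rfl; omega
      have hbc : b ≠ c := by rintro rfl; omega
      have hq : ∀ e ∈ q.edges, e ∈ (G.rewire a c h).edgeSet := by
        intro e he
        have heG := q.edges_subset_edgeSet he
        induction e with
        | _ u v =>
          have hu := q.fst_mem_support_of_mem_edges he
          have hv := q.snd_mem_support_of_mem_edges he
          refine (SimpleGraph.rewire_adj hch).2 (Or.inl ⟨heG, ?_⟩)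
          rintro (⟨rfl, -⟩ | ⟨-, rfl⟩)
          · exact hp.2 hu
          · exact hp.2 hv
      obtain ⟨G', hr, hconn', hsum', hlt⟩ := ih hconn (q.transfer _ hq) (hp.1.transfer hq)
        (by rw [degree_rewire_right hac.ne hch nch]; omega)
        (by rwa [degree_rewire_of_ne hah hch aah nch hba hbc])
        (by rw [SimpleGraph.Walk.length_transfer]; omega)
      refine ⟨G', .head hstep hr, hconn', hsum'.trans hsum, hlt.trans_le ?_⟩
      subst hdk
      rw [hck] at hsq
      omega

lemma exists_reflTransGen_isRegularOfDegree {V : Type*} [Fintype V] {G : SimpleGraph V}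
    (hG : G.Connected) {k : ℕ} (hsum : ∑ v, G.degree v = Fintype.card V * k) :
    ∃ G' : SimpleGraph V, Relation.ReflTransGen R1Step G G' ∧
      G'.Connected ∧ G'.IsRegularOfDegree k := by
  induction hS : ∑ v, G.degree v ^ 2 using Nat.strong_induction_on generalizing G with
  | _ S ih =>
    have hconst : ∑ _v : V, k = Fintype.card V * k := by simp
    by_cases hlow : ∀ v, k ≤ G.degree v
    · have := (Finset.sum_eq_sum_iff_of_le fun v _ => hlow v).1 (hconst.trans hsum.symm)
      exact ⟨G, .refl, hG, fun v => (this v (Finset.mem_univ v)).symm⟩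
    by_cases hhigh : ∀ v, G.degree v ≤ k
    · have := (Finset.sum_eq_sum_iff_of_le fun v _ => hhigh v).1 (hsum.trans hconst.symm)
      exact ⟨G, .refl, hG, fun v => this v (Finset.mem_univ v)⟩
    push Not at hlow hhigh
    obtain ⟨b, hb⟩ := hlow
    obtain ⟨a, ha⟩ := hhigh
    obtain ⟨p, hp⟩ := hG.exists_isPath a b
    obtain ⟨G₁, hr₁, hconn, hsum₁, hlt⟩ :=
      exists_reflTransGen_sum_sq_degree_lt hG p hp ha hb
    obtain ⟨G₂, hr₂, h₂⟩ := ih _ (hS ▸ hlt) hconn (hsum₁.trans hsum) rfl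
    exact ⟨G₂, hr₁.trans hr₂, h₂⟩

/-- **Theorem 1, integer case.** A connected graph whose average degree
`k = 2|E|/n` is an integer can be transformed by a finite sequence of r1-rewirings
into a connected `k`-regular graph. -/
theorem r1_reaches_regular {V : Type*} [Fintype V] (G : SimpleGraph V)
    (hG : G.Connected) (k : ℕ)
    (hdvd : Fintype.card V ∣ 2 * G.edgeFinset.card)
    (hk : k = 2 * G.edgeFinset.card / Fintype.card V) :
    ∃ G' : SimpleGraph V, Relation.ReflTransGen R1Step G G' ∧
      G'.Connected ∧ G'.IsRegularOfDegree k := by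
  refine exists_reflTransGen_isRegularOfDegree hG ?_
  rw [hk, Nat.mul_div_cancel' hdvd, ← G.sum_degrees_eq_twice_card_edges]
end

section
/- Let G be a connected triangle-free simple graph on n vertices with more than n edges (equivalently, average degree greater than 2). Then there exists a finite sequence of graphs G = G_0, G_1, …, G_T such that each G_{t+1} is obtained from G_t by an r2-swap (for distinct vertices i, j, h, f with i~j, i~h, j~f, ¬i~f, ¬j~h, deleting the edges {i,h} and {j,f} and adding the edges {i,f} and {j,h}), and G_T contains a triangle. -/
open SimpleGraph
open scoped Classical

/-- One application of the neighbor-swap rule r2: for distinct vertices `i, j, h, f`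
with `i ~ j`, `i ~ h`, `j ~ f`, `¬ i ~ f`, `¬ j ~ h`, delete the edges `{i,h}` and
`{j,f}` and add the edges `{i,f}` and `{j,h}`. -/
def R2Step {V : Type*} (G G' : SimpleGraph V) : Prop :=
  ∃ i j h f : V,
    i ≠ j ∧ i ≠ h ∧ i ≠ f ∧ j ≠ h ∧ j ≠ f ∧ h ≠ f ∧
    G.Adj i j ∧ G.Adj i h ∧ G.Adj j f ∧ ¬ G.Adj i f ∧ ¬ G.Adj j h ∧
    G' = G.deleteEdges {s(i, h), s(j, f)} ⊔ SimpleGraph.fromEdgeSet {s(i, f), s(j, h)}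

/-- If `v` lies on a cycle (closed up by the path `p` between two of its neighbors `a`, `b`) and has
a third neighbor `h`, then r2-swaps can shorten the cycle until it is a triangle. -/
theorem exists_r2_triangle_of_path {V : Type*} (n : ℕ) :
    ∀ (G : SimpleGraph V) (v h a b : V) (p : G.Walk a b), p.length = n → p.IsPath →
      v ∉ p.support → G.Adj v a → G.Adj v b → G.Adj v h → h ≠ a → h ≠ b → a ≠ b →
      ∃ G' : SimpleGraph V, Relation.ReflTransGen R2Step G G' ∧ ¬ G'.CliqueFree 3 := by
  induction n with
  | zero =>
    intro G v h a b p hp _ _ _ _ _ _ _ hab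
    exact absurd (Walk.eq_of_length_eq_zero hp) hab
  | succ n ih =>
    intro G v h a b p hp hpath hv hva hvb hvh hha hhb hab
    by_cases htf : G.CliqueFree 3
    swap
    · exact ⟨G, .refl, htf⟩
    have not_triangle : ∀ x y z, G.Adj x y → G.Adj x z → ¬ G.Adj y z := fun x y z hxy hxz hyz =>
      htf {x, y, z} (is3Clique_triple_iff.2 ⟨hxy, hxz, hyz⟩)
    cases p with
    | nil => exact absurd rfl hab
    | @cons _ c _ hac q =>
      obtain ⟨hq, haq⟩ := (Walk.cons_isPath_iff _ _).1 hpath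
      simp only [Walk.support_cons, List.mem_cons, not_or] at hv
      obtain ⟨_, hvq⟩ := hv
      have hvc : ¬ G.Adj v c := not_triangle a v c hva.symm hac
      have hcv : v ≠ c := fun e => hvq (e ▸ q.start_mem_support)
      have hhc : h ≠ c := fun e => hvc (e ▸ hvh)
      have hcb : c ≠ b := fun e => hvc (e ▸ hvb)
      have hah : ¬ G.Adj a h := not_triangle v a h hva hvh
      set H := G.deleteEdges {s(v, h), s(a, c)} ⊔ SimpleGraph.fromEdgeSet {s(v, c), s(a, h)}
        with hH
      have step : R2Step G H := ⟨v, a, h, c, hva.ne, hvh.ne, hcv, hha.symm, hac.ne, hhc,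
        hva, hvh, hac, hvc, hah, hH⟩
      have adj_of : ∀ x y, G.Adj x y → s(x, y) ≠ s(v, h) → s(x, y) ≠ s(a, c) → H.Adj x y := by
        intro x y hxy h₁ h₂
        simp [hH, hxy, -Sym2.eq, h₁, h₂]
      have hedges : ∀ e ∈ q.edges, e ∈ H.edgeSet := by
        intro e
        induction e with
        | _ x y =>
          intro he
          refine adj_of x y (q.adj_of_mem_edges he) (fun e => ?_) (fun e => ?_)
          · exact hvq (q.fst_mem_support_of_mem_edges (e ▸ he))
          · exact haq (q.fst_mem_support_of_mem_edges (e ▸ he))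
      obtain ⟨G', hG', hfree⟩ := ih H v a c b (q.transfer H hedges)
        (by simpa using hp) (hq.transfer hedges) (by simpa using hvq)
        (by simp [hH, hcv])
        (adj_of v b hvb (by simp [hhb.symm, hvh.ne]) (by simp [hva.ne, hcv]))
        (adj_of v a hva (by simp [hha.symm, hvh.ne]) (by simp [hva.ne, hcv]))
        hac.ne hab hcb
      exact ⟨G', hG'.head step, hfree⟩

/-- A vertex of a cycle is joined to two distinct vertices of the cycle by edges that are closed up
to a cycle by a path avoiding that vertex. -/
theorem SimpleGraph.Walk.IsCycle.exists_isPath_avoiding {V : Type*} {G : SimpleGraph V} {v : V}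
    {c : G.Walk v v} (hc : c.IsCycle) {u : V} (hu : u ∈ c.support) :
    ∃ (a b : V) (p : G.Walk a b), p.IsPath ∧ u ∉ p.support ∧ G.Adj u a ∧ G.Adj u b ∧ a ≠ b ∧
      a ∈ c.support ∧ b ∈ c.support := by
  have hr := hc.rotate hu
  have hsupp : ∀ x, x ∈ (c.rotate u hu).support → x ∈ c.support := fun x => by
    simp
  generalize c.rotate u hu = d at hr hsupp
  cases d with
  | nil => exact absurd hr Walk.not_isCycle_nil
  | @cons _ a _ hua p =>
    obtain ⟨hp, hnot⟩ := (Walk.cons_isCycle_iff _ _).1 hr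
    have hrev := hp.reverse
    have hedge : s(u, a) ∉ p.reverse.edges := by simpa using hnot
    have hmem : ∀ x, x ∈ p.reverse.support → x ∈ c.support := fun x hx =>
      hsupp x (by simp at hx; simp [hx])
    generalize p.reverse = r at hrev hedge hmem
    cases r with
    | nil => exact absurd hua (G.loopless.irrefl _)
    | @cons _ b _ hub q =>
      obtain ⟨hq, huq⟩ := (Walk.cons_isPath_iff _ _).1 hrev
      refine ⟨b, a, q, hq, huq, hub, hua, ?_, hmem _ (by simp), hmem _ (by simp)⟩
      rintro rfl
      simp at hedge

/-- **Triangle formation via r2.** A connected triangle-free graph on `n` vertices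
with more than `n` edges (average degree greater than 2) can be transformed by a
finite sequence of r2-swaps into a graph containing a triangle. -/
theorem r2_reaches_triangle {V : Type*} [Fintype V] (G : SimpleGraph V)
    (hG : G.Connected) (htf : G.CliqueFree 3)
    (he : Fintype.card V < G.edgeFinset.card) :
    ∃ G' : SimpleGraph V, Relation.ReflTransGen R2Step G G' ∧ ¬ G'.CliqueFree 3 := by
  by_contra hno
  have hcyc : ¬ G.IsAcyclic := fun hac => by
    have := (IsTree.mk hG hac).card_edgeFinset
    omega
  obtain ⟨v, c, hc⟩ : ∃ (v : V) (c : G.Walk v v), c.IsCycle := by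
    simpa [IsAcyclic] using hcyc
  have key : ∀ u ∈ c.support, ∃ a ∈ c.support, ∃ b ∈ c.support, ∀ x, G.Adj u x → x = a ∨ x = b := by
    intro u hu
    obtain ⟨a, b, p, hp, hup, hua, hub, hab, ha, hb⟩ := hc.exists_isPath_avoiding hu
    refine ⟨a, ha, b, hb, fun x hx => ?_⟩
    by_contra! hne
    exact hno (exists_r2_triangle_of_path _ G u x a b p rfl hp hup hua hub hx hne.1 hne.2 hab)
  have closed : ∀ {u w : V}, G.Walk u w → u ∈ c.support → w ∈ c.support := by
    intro u w p
    induction p with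
    | nil => exact id
    | cons h _ ih =>
      intro hu
      obtain ⟨a, ha, b, hb, hx⟩ := key _ hu
      rcases hx _ h with rfl | rfl
      exacts [ih ha, ih hb]
  have hdeg : ∀ u, G.degree u ≤ 2 := by
    intro u
    obtain ⟨p⟩ := hG.preconnected v u
    obtain ⟨a, -, b, -, hx⟩ := key u (closed p c.start_mem_support)
    rw [← card_neighborFinset_eq_degree]
    refine (Finset.card_le_card (t := {a, b}) fun x hxu => ?_).trans Finset.card_le_two
    simpa using hx x (by simpa using hxu)
  have hsum := G.sum_degrees_eq_twice_card_edges
  have hle : ∑ u, G.degree u ≤ ∑ _u : V, 2 := Finset.sum_le_sum fun u _ => hdeg u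
  simp only [Finset.sum_const, Finset.card_univ, smul_eq_mul] at hle
  omega
end

section
/- Let G be a connected simple graph on n vertices that is triangle-free and has more than n edges. Then G contains a cycle C of length at least 4 that does not pass through all vertices of G, and there exist a vertex i on C and a vertex h not on C such that i is adjacent to h. -/
open SimpleGraph
open scoped Classical

namespace SimpleGraph

variable {V : Type*} {G : SimpleGraph V}

lemma CliqueFree.four_le_length_of_isCycle (htf : G.CliqueFree 3) {v : V} {c : G.Walk v v}
    (hc : c.IsCycle) : 4 ≤ c.length := by
  by_contra hlt
  have hlen : c.length = 3 := by have := hc.three_le_length; lia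
  obtain ⟨s, hs⟩ := is3Clique_iff_exists_cycle_length_three.mpr ⟨v, c, hc, hlen⟩
  exact htf s hs

lemma Walk.IsCycle.length_le_card [Fintype V] {v : V} {c : G.Walk v v} (hc : c.IsCycle) :
    c.length ≤ Fintype.card V := by
  simpa using hc.support_nodup.length_le_card

lemma Walk.exists_adj_notMem_edges [Fintype V] {u v : V} (c : G.Walk u v)
    (hc : c.length < G.edgeFinset.card) : ∃ x y, G.Adj x y ∧ s(x, y) ∉ c.edges := by
  have hlt : c.edges.toFinset.card < G.edgeFinset.card :=
    (c.edges.toFinset_card_le.trans_eq c.length_edges).trans_lt hc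
  obtain ⟨e, he, hec⟩ := Finset.exists_mem_notMem_of_card_lt_card hlt
  induction e with
  | h x y => exact ⟨x, y, by simpa using he, by simpa using hec⟩

/-- A chord of a cycle cuts off a cycle that misses a vertex. -/
lemma Walk.IsCycle.exists_isCycle_notMem_support_of_chord [Fintype V] {x y : V} {c : G.Walk x x}
    (hc : c.IsCycle) (hy : y ∈ c.support) (hxy : G.Adj x y) (hne : s(x, y) ∉ c.edges) :
    ∃ (v : V) (d : G.Walk v v), d.IsCycle ∧ ∃ w, w ∉ d.support := by
  have hsplit := c.take_spec hy
  set p := c.takeUntil y hy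
  set q := c.dropUntil y hy
  have hp : p.IsPath := hc.isPath_takeUntil hy
  have hpe : s(y, x) ∉ p.edges := fun h ↦
    hne (Sym2.eq_swap ▸ c.edges_takeUntil_subset_edges hy h)
  have hlen : p.length + q.length ≤ Fintype.card V := by
    rw [← Walk.length_append, hsplit]
    exact hc.length_le_card
  have hq : 2 ≤ q.length := by
    by_contra! hlt
    have hq0 : q.length ≠ 0 := fun h ↦ hxy.ne' (Walk.eq_of_length_eq_zero h)
    have hqe : s(x, y) ∉ q.edges := fun h ↦ hne (c.edges_dropUntil_subset_edges hy h)
    have hq1 : q.length = 1 := by lia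
    clear_value q
    cases q with
    | nil => simp at hq0
    | cons h q' =>
      have hq' : q'.length = 0 := by simpa using hq1
      obtain rfl := Walk.eq_of_length_eq_zero hq'
      exact hqe (by simp [Sym2.eq_swap])
  refine ⟨y, p.cons hxy.symm, (Walk.cons_isCycle_iff p hxy.symm).mpr ⟨hp, hpe⟩, ?_⟩
  have hcard : p.support.toFinset.card < Fintype.card V := by
    grw [List.toFinset_card_le, Walk.length_support]
    lia
  obtain ⟨w, -, hw⟩ := Finset.exists_mem_notMem_of_card_lt_card (t := Finset.univ) hcard
  refine ⟨w, fun h ↦ hw ?_⟩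
  rw [Walk.support_cons, List.mem_cons] at h
  rw [List.mem_toFinset]
  exact h.elim (fun h ↦ h ▸ p.end_mem_support) id

lemma Connected.exists_isCycle_of_card_lt [Fintype V] (hG : G.Connected)
    (he : Fintype.card V < G.edgeFinset.card) : ∃ (v : V) (c : G.Walk v v), c.IsCycle := by
  by_contra! h
  have := (IsTree.mk hG fun v c ↦ h v c).card_edgeFinset
  lia

lemma Connected.exists_isCycle_notMem_support [Fintype V] (hG : G.Connected)
    (he : Fintype.card V < G.edgeFinset.card) :
    ∃ (v : V) (c : G.Walk v v), c.IsCycle ∧ ∃ u, u ∉ c.support := by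
  obtain ⟨v, c, hc⟩ := hG.exists_isCycle_of_card_lt he
  by_cases! hspan : ∃ u, u ∉ c.support
  · exact ⟨v, c, hc, hspan⟩
  obtain ⟨x, y, hxy, hne⟩ := c.exists_adj_notMem_edges (hc.length_le_card.trans_lt he)
  have hx := hspan x
  exact (hc.rotate hx).exists_isCycle_notMem_support_of_chord
    ((c.mem_support_rotate_iff x hx).mpr (hspan y)) hxy
    (fun h ↦ hne ((c.rotate_edges x hx).mem_iff.mp h))

lemma Connected.exists_adj_mem_notMem (hG : G.Connected) {S : Set V} {v u : V} (hv : v ∈ S)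
    (hu : u ∉ S) : ∃ i ∈ S, ∃ h ∉ S, G.Adj i h := by
  obtain ⟨p⟩ := hG v u
  obtain ⟨d, -, h₁, h₂⟩ := p.exists_boundary_dart S hv hu
  exact ⟨d.fst, h₁, d.snd, h₂, d.adj⟩

end SimpleGraph

/-- **Structural core of the triangle-formation lemma.** A connected triangle-free
graph on `n` vertices with more than `n` edges contains a cycle of length at least 4
that avoids some vertex, together with a vertex `i` on the cycle adjacent to a vertex
`h` off the cycle. -/
theorem triangle_free_cycle_structure {V : Type*} [Fintype V] (G : SimpleGraph V)
    (hG : G.Connected) (htf : G.CliqueFree 3)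
    (he : Fintype.card V < G.edgeFinset.card) :
    ∃ (v : V) (c : G.Walk v v), c.IsCycle ∧ 4 ≤ c.length ∧
      (∃ u : V, u ∉ c.support) ∧
      ∃ i ∈ c.support, ∃ h : V, h ∉ c.support ∧ G.Adj i h := by
  obtain ⟨v, c, hc, u, hu⟩ := hG.exists_isCycle_notMem_support he
  obtain ⟨i, hi, h, hh, hadj⟩ :=
    hG.exists_adj_mem_notMem (S := {w | w ∈ c.support}) c.start_mem_support hu
  exact ⟨v, c, hc, htf.four_le_length_of_isCycle hc, ⟨u, hu⟩, i, hi, h, hh, hadj⟩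
end
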